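/- Let h, h', M be positive integers with h' ≥ h(M−1)+1, and let Γ be an injective straight-line drawing in ℝ² of the complete 10-ary tree T_10^{h'}. Suppose there do not exist M edges e_1, …, e_M of T_10^{h'} with e_1 >_FD e_2 >_FD ⋯ >_FD e_M in Γ. Then there exists a vertex v of T_10^{h'} with depth d_v satisfying 1 ≤ d_v ≤ h'−h such that no edge of the subtree T_10^h(v) dominates the edge (v, v'), where v' is the parent of v (the neighbor of v with depth d_v−1). -/

import Mathlib

/-- Vertices of the complete 10-ary tree are finite sequences over `Fin 10` (`List (Fin 10)`),
the root being `[]`, the parent of a nonempty sequence its tail, and the depth of a vertex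
its length. Each edge is identified with its lower endpoint (a nonempty list `l`); its drawn
length is the distance between the images of its endpoints. -/
noncomputable def edgeLen10 (Γ : List (Fin 10) → EuclideanSpace ℝ (Fin 2))
    (l : List (Fin 10)) : ℝ :=
  dist (Γ l.tail) (Γ l)

/-- First-hand domination in a drawing `Γ`: the edge with lower endpoint `a` first-hand
dominates the edge with lower endpoint `b` if (i) the latter lies on the path from the
former to the root, i.e. `a.drop k = b` for some `k ≥ 1` (so there are `s = k - 1` edges
strictly between them), (ii) `ℓ(a\text{-edge}) ≥ 3 ^ (s+1) · ℓ(b\text{-edge}) = 3 ^ k · ℓ(b\text{-edge})`,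
and (iii) no edge strictly between them (lower endpoint `a.drop j`, `1 ≤ j < k`) dominates
the `b`-edge. -/
noncomputable def dominatesFD10 (Γ : List (Fin 10) → EuclideanSpace ℝ (Fin 2))
    (a b : List (Fin 10)) : Prop :=
  ∃ k : ℕ, 1 ≤ k ∧ a.drop k = b ∧
    3 ^ k * edgeLen10 Γ b ≤ edgeLen10 Γ a ∧
    ∀ j : ℕ, 1 ≤ j → j < k →
      ¬ (3 ^ (k - j) * edgeLen10 Γ b ≤ edgeLen10 Γ (a.drop j))

/-- Lemma: let `h, h', M ≥ 1` with `h' ≥ h(M-1)+1` and let `Γ` be an injective drawing of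
the complete 10-ary tree of height `h'` (vertices: lists of length `≤ h'`). If `Γ` contains
no `M` edges `e 0 >_FD e 1 >_FD ⋯ >_FD e (M-1)`, then there is a vertex `v` of depth
`1 ≤ d_v ≤ h' - h` such that no edge of the subtree `T₁₀ʰ(v)` (edges with lower endpoint
`b`, `b.drop k = v`, `1 ≤ k ≤ h`) dominates the edge from `v` to its parent. -/
theorem stmt9 (h h' M : ℕ) (hh : 1 ≤ h) (hh' : 1 ≤ h') (hM : 1 ≤ M)
    (hbound : h * (M - 1) + 1 ≤ h')
    (Γ : List (Fin 10) → EuclideanSpace ℝ (Fin 2))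
    (hinj : ∀ l₁ l₂ : List (Fin 10),
      l₁.length ≤ h' → l₂.length ≤ h' → Γ l₁ = Γ l₂ → l₁ = l₂)
    (hno : ¬ ∃ e : ℕ → List (Fin 10),
      (∀ j < M, e j ≠ [] ∧ (e j).length ≤ h') ∧
      (∀ j : ℕ, j + 1 < M → dominatesFD10 Γ (e j) (e (j + 1)))) :
    ∃ v : List (Fin 10), 1 ≤ v.length ∧ v.length ≤ h' - h ∧
      ∀ b : List (Fin 10), ∀ k : ℕ, 1 ≤ k → k ≤ h → b.drop k = v →
        ¬ (3 ^ k * edgeLen10 Γ v ≤ edgeLen10 Γ b) := by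
  classical
  by_contra hcon
  push Not at hcon
  have step : ∀ v : List (Fin 10), ∃ b : List (Fin 10), 1 ≤ v.length → v.length ≤ h' - h →
      dominatesFD10 Γ b v ∧ 1 ≤ b.length ∧ b.length ≤ v.length + h := by
    intro v
    by_cases hv : 1 ≤ v.length ∧ v.length ≤ h' - h
    swap
    · exact ⟨[], fun h1 h2 => absurd ⟨h1, h2⟩ hv⟩
    obtain ⟨b0, k0, h1, h2, h3, h4⟩ := hcon v hv.1 hv.2
    have hex : ∃ k, ∃ b : List (Fin 10), 1 ≤ k ∧ k ≤ h ∧ b.drop k = v ∧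
        3 ^ k * edgeLen10 Γ v ≤ edgeLen10 Γ b := ⟨k0, b0, h1, h2, h3, h4⟩
    obtain ⟨b, hk1, hkh, hd, hl⟩ := Nat.find_spec hex
    have hmin := fun m => @Nat.find_min _ _ hex m
    generalize Nat.find hex = k at *
    refine ⟨b, fun _ _ => ⟨⟨k, hk1, hd, hl, ?_⟩, ?_⟩⟩
    · intro j hj1 hjk hdom
      refine hmin (k - j) (by omega) ⟨b.drop j, by omega, by omega, ?_, hdom⟩
      rw [List.drop_drop, show j + (k - j) = k by omega, hd]
    · have := congrArg List.length hd
      rw [List.length_drop] at this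
      omega
  choose g hg using step
  let u : ℕ → List (Fin 10) := fun n => Nat.rec [0] (fun _ v => g v) n
  have husucc : ∀ n, u (n + 1) = g (u n) := fun n => rfl
  have hroom : ∀ n, n + 1 < M → h * n + 1 ≤ h' - h := by
    intro n hn
    have : h * (n + 1) ≤ h * (M - 1) := Nat.mul_le_mul_left h (by omega)
    rw [Nat.mul_succ] at this
    omega
  have hu : ∀ n, n < M → 1 ≤ (u n).length ∧ (u n).length ≤ h * n + 1 := by
    intro n
    induction n with
    | zero => intro _; simp [u]
    | succ n ih =>
      intro hn
      obtain ⟨i1, i2⟩ := ih (by omega)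
      have := hg (u n) i1 (i2.trans (hroom n hn))
      rw [husucc, Nat.mul_succ]
      omega
  refine hno ⟨fun j => u (M - 1 - j), ?_, ?_⟩
  · intro j hj
    obtain ⟨i1, i2⟩ := hu (M - 1 - j) (by omega)
    have : h * (M - 1 - j) ≤ h * (M - 1) := Nat.mul_le_mul_left h (by omega)
    refine ⟨?_, by beta_reduce; omega⟩
    exact List.ne_nil_of_length_pos i1
  · intro j hj
    obtain ⟨i1, i2⟩ := hu (M - 1 - (j + 1)) (by omega)
    have := (hg _ i1 (i2.trans (hroom _ (by omega)))).1
    rw [← husucc, show M - 1 - (j + 1) + 1 = M - 1 - j by omega] at this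
    exact this
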